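/- arXiv:1807.07691 — 2 statements merged into one kernel-verified Lean document; each statement's English description precedes it below -/
import Mathlib

section
/- Let n ≥ 2 and let a : Fin n → ℕ be a monotone (nondecreasing) sequence. Then for every permutation σ of Fin n, the sum of prefix products in the sorted order is at most the sum of prefix products in the permuted order: Σ_{k=1}^{n-1} ∏_{j=0}^{k} a(j) ≤ Σ_{k=1}^{n-1} ∏_{j=0}^{k} a(σ(j)). -/
/-- For a nondecreasing sequence `a : Fin n → ℕ` (with `n ≥ 2`) and any permutation `σ`
of `Fin n`, the sum of prefix products `Σ_{k=1}^{n-1} ∏_{j=0}^{k} a j` in sorted order is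
at most the sum of prefix products `Σ_{k=1}^{n-1} ∏_{j=0}^{k} a (σ j)` in permuted order. -/
theorem sum_prefix_prod_monotone_le_perm (n : ℕ) (hn : 2 ≤ n) (a : Fin n → ℕ)
    (ha : Monotone a) (σ : Equiv.Perm (Fin n)) :
    ∑ k ∈ Finset.univ.filter (fun k : Fin n => (⟨0, by omega⟩ : Fin n) < k),
        ∏ j ∈ Finset.Iic k, a j ≤
      ∑ k ∈ Finset.univ.filter (fun k : Fin n => (⟨0, by omega⟩ : Fin n) < k),
        ∏ j ∈ Finset.Iic k, a (σ j) := by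
  apply Finset.sum_le_sum
  intro k _
  have h1 : ∏ j ∈ Finset.Iic k, a (σ j) = ∏ j ∈ (Finset.Iic k).map σ.toEmbedding, a j := by
    rw [Finset.prod_map]; rfl
  rw [h1]
  have hc : ((Finset.Iic k).map σ.toEmbedding).card = (Finset.Iic k).card := Finset.card_map _
  generalize (Finset.Iic k).map σ.toEmbedding = T at hc
  rw [← Finset.prod_inter_mul_prod_diff (Finset.Iic k) T a,
    ← Finset.prod_inter_mul_prod_diff T (Finset.Iic k) a, Finset.inter_comm T]
  apply Nat.mul_le_mul_left
  have hd : (Finset.Iic k \ T).card = (T \ Finset.Iic k).card :=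
    Finset.card_sdiff_comm hc.symm
  calc ∏ j ∈ Finset.Iic k \ T, a j ≤ a k ^ (Finset.Iic k \ T).card := by
        apply Finset.prod_le_pow_card
        intro x hx
        exact ha (Finset.mem_Iic.1 (Finset.mem_sdiff.1 hx).1)
    _ = a k ^ (T \ Finset.Iic k).card := by rw [hd]
    _ ≤ ∏ j ∈ T \ Finset.Iic k, a j := by
        apply Finset.pow_card_le_prod
        intro x hx
        have := (Finset.mem_sdiff.1 hx).2
        rw [Finset.mem_Iic, not_le] at this
        exact ha this.le
end

section
/- Let U be a type and let R₁, …, Rₙ (n ≥ 2) be finite relations over U with finite schemas, such that |R₁| ≤ |R₂| ≤ ⋯ ≤ |Rₙ|. Define δ(R₁, …, Rₙ) = Σ_{k=2}^{n} |R₁ ⋈ ⋯ ⋈ R_k| as the total number of left-deep intermediate join results in this sorted order. Then for every permutation (R_{i₁}, …, R_{iₙ}) of the relations, δ(R₁, …, Rₙ) ≤ Σ_{k=2}^{n} ∏_{j=1}^{k} |R_{i_j}| = |R_{i₁}||R_{i₂}| + ⋯ + |R_{i₁}|⋯|R_{iₙ}|. -/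
/-- A relation over universe `U`: a schema (finite set of variables) together with a
set of tuples (functions from the schema to `U`). -/
structure DBRel (V U : Type*) where
  schema : Finset V
  rel : Set ({x // x ∈ schema} → U)

/-- The natural join of two relations: its schema is the union of the schemas, and its
tuples are those whose restrictions to the two schemas lie in the respective relations. -/
def DBRel.join {V U : Type*} [DecidableEq V] (R₁ R₂ : DBRel V U) : DBRel V U where
  schema := R₁.schema ∪ R₂.schema
  rel := {t | (fun x => t ⟨x.1, Finset.subset_union_left x.2⟩) ∈ R₁.rel ∧
              (fun x => t ⟨x.1, Finset.subset_union_right x.2⟩) ∈ R₂.rel}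

/-- The left-deep partial joins: `partialJoin R k = R 0 ⋈ R 1 ⋈ ⋯ ⋈ R k`. -/
def partialJoin {V U : Type*} [DecidableEq V] (R : ℕ → DBRel V U) : ℕ → DBRel V U
  | 0 => R 0
  | k + 1 => (partialJoin R k).join (R (k + 1))

theorem join_finite_card {V U : Type*} [DecidableEq V] (A B : DBRel V U)
    (hA : A.rel.Finite) (hB : B.rel.Finite) :
    (A.join B).rel.Finite ∧ (A.join B).rel.ncard ≤ A.rel.ncard * B.rel.ncard := by
  let g : ({x // x ∈ (A.join B).schema} → U) →
      ({x // x ∈ A.schema} → U) × ({x // x ∈ B.schema} → U) := fun t =>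
    (fun x => t ⟨x.1, Finset.subset_union_left x.2⟩,
     fun x => t ⟨x.1, Finset.subset_union_right x.2⟩)
  have hg : Function.Injective g := by
    intro t u h
    funext ⟨x, hx⟩
    have h1 := congrArg Prod.fst h
    have h2 := congrArg Prod.snd h
    rcases Finset.mem_union.1 hx with hx' | hx'
    · exact congrFun h1 ⟨x, hx'⟩
    · exact congrFun h2 ⟨x, hx'⟩
  have hm : ∀ t ∈ (A.join B).rel, g t ∈ A.rel ×ˢ B.rel := fun t ht => ⟨ht.1, ht.2⟩
  have hf : (A.rel ×ˢ B.rel).Finite := hA.prod hB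
  refine ⟨Set.Finite.of_injOn hm hg.injOn hf, ?_⟩
  rw [← Set.ncard_prod]
  exact Set.ncard_le_ncard_of_injOn g hm hg.injOn hf

theorem partialJoin_finite_card {V U : Type*} [DecidableEq V] (R : ℕ → DBRel V U) (n : ℕ)
    (hfin : ∀ i, i < n → (R i).rel.Finite) (k : ℕ) (hk : k < n) :
    (partialJoin R k).rel.Finite ∧
      (partialJoin R k).rel.ncard ≤ ∏ j ∈ Finset.range (k + 1), (R j).rel.ncard := by
  induction k with
  | zero => exact ⟨hfin 0 hk, by simp [partialJoin]⟩
  | succ k ih =>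
    obtain ⟨h1, h2⟩ := ih (by omega)
    obtain ⟨h3, h4⟩ := join_finite_card (partialJoin R k) (R (k + 1)) h1 (hfin _ hk)
    refine ⟨h3, h4.trans ?_⟩
    rw [Finset.prod_range_succ _ (k + 1)]
    exact Nat.mul_le_mul_right _ h2

theorem prod_range_le_prod (n : ℕ) (f : ℕ → ℕ)
    (hf : ∀ i j, i ≤ j → j < n → f i ≤ f j) (m : ℕ) :
    ∀ s : Finset ℕ, (∀ x ∈ s, x < n) → s.card = m →
      ∏ j ∈ Finset.range m, f j ≤ ∏ j ∈ s, f j := by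
  induction m with
  | zero =>
    intro s _ h
    simp [Finset.card_eq_zero.1 h]
  | succ m ih =>
    intro s hs h
    obtain ⟨M, hM, hmM⟩ : ∃ M ∈ s, m ≤ M := by
      by_contra! hc
      have : s ⊆ Finset.range m := fun x hx => Finset.mem_range.2 (hc x hx)
      have := Finset.card_le_card this
      simp at this
      omega
    rw [Finset.prod_range_succ, ← Finset.prod_erase_mul s f hM]
    exact Nat.mul_le_mul
      (ih _ (fun x hx => hs x (Finset.mem_of_mem_erase hx))
        (by rw [Finset.card_erase_of_mem hM]; omega))
      (hf _ _ hmM (hs M hM))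

/-- Theorem 2 (min-boundary): if the relations `R 0, …, R (n-1)` are sorted so that
`|R 0| ≤ |R 1| ≤ ⋯ ≤ |R (n-1)|`, then the total number of left-deep intermediate join
results in this sorted order, `δ = Σ_{k=2}^{n} |R₁ ⋈ ⋯ ⋈ R_k|`, is at most the sum of
prefix products of cardinalities `Σ_{k=2}^{n} |R_{i₁}|⋯|R_{i_k}|` for any permutation
`(R_{i₁}, …, R_{iₙ})` of the relations (encoded as a permutation `σ` of `ℕ` mapping
the indices `{0, …, n-1}` into themselves). -/
theorem delta_sorted_le_perm_prefix_products {V U : Type*} [DecidableEq V]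
    (n : ℕ) (hn : 2 ≤ n) (R : ℕ → DBRel V U)
    (hfin : ∀ i, i < n → (R i).rel.Finite)
    (hsorted : ∀ i j, i ≤ j → j < n → (R i).rel.ncard ≤ (R j).rel.ncard)
    (σ : Equiv.Perm ℕ) (hσ : ∀ i, i < n → σ i < n) :
    ∑ k ∈ Finset.Ico 1 n, (partialJoin R k).rel.ncard ≤
      ∑ k ∈ Finset.Ico 1 n, ∏ j ∈ Finset.range (k + 1), (R (σ j)).rel.ncard := by
  refine Finset.sum_le_sum fun k hk => ?_
  have hk' := (Finset.mem_Ico.1 hk).2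
  refine (partialJoin_finite_card R n hfin k hk').2.trans ?_
  have := prod_range_le_prod n (fun i => (R i).rel.ncard) hsorted (k + 1)
    ((Finset.range (k + 1)).map σ.toEmbedding) (by
      intro x hx
      obtain ⟨i, hi, rfl⟩ := Finset.mem_map.1 hx
      exact hσ i (by have := Finset.mem_range.1 hi; omega)) (by simp)
  rw [Finset.prod_map] at this
  exact this
end
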